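/- For every integer t ≥ 3 there exists a finite Restivo word of the form x_0 μ(x_1) ⋯ μ^{t-1}(x_{t-1}) with x_0, …, x_{t-1} ∈ S containing a factor of length 2^t − 1 that has period 2^{t-2}, hence a factor of exponent 4(1 − 2^{-t}). Consequently, for every real number e < 4 there exists an infinite Restivo word containing a nonempty factor of exponent greater than e, so the bound 4 in the statement that every infinite Restivo word avoids 4-powers is best possible. -/

import Mathlib

/-- The Thue–Morse morphism μ : 0 ↦ 01, 1 ↦ 10 (false = 0, true = 1),
extended to finite binary words. -/
def mu (w : List Bool) : List Bool := (w.map (fun b => [b, !b])).flatten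

/-- The set S = {ε, 0, 1, 00, 11}. -/
def S : Set (List Bool) := {[], [false], [true], [false, false], [true, true]}

/-- A finite word `u` is a prefix of the infinite word `w`. -/
def PrefixSeq {α : Type*} (u : List α) (w : ℕ → α) : Prop :=
  ∀ (j : ℕ) (h : j < u.length), u.get ⟨j, h⟩ = w j

/-- A finite word `u` is a factor of the infinite word `w`. -/
def IsFactorSeq (u : List Bool) (w : ℕ → Bool) : Prop :=
  ∃ i : ℕ, ∀ (j : ℕ) (h : j < u.length), u.get ⟨j, h⟩ = w (i + j)

/-- The finite word `u` has period `p` (with `1 ≤ p ≤ |u|`):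
`u[i] = u[i+p]` for all `0 ≤ i < |u| - p`. -/
def HasPeriod (u : List Bool) (p : ℕ) : Prop :=
  1 ≤ p ∧ p ≤ u.length ∧ ∀ i, i + p < u.length → u.getD i false = u.getD (i + p) false

/-- The least period of a finite word. -/
noncomputable def leastPeriod (u : List Bool) : ℕ := sInf {p | HasPeriod u p}

/-- The exponent of a nonempty finite word: its length divided by its least period. -/
noncomputable def exponent (u : List Bool) : ℚ := (u.length : ℚ) / (leastPeriod u : ℚ)

/-- A finite word avoids α-powers: no nonempty factor has exponent ≥ α. -/
def AvoidsPow (a : ℚ) (w : List Bool) : Prop :=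
  ∀ u : List Bool, u ≠ [] → u <:+: w → exponent u < a

/-- A finite word avoids α⁺-powers: no nonempty factor has exponent > α. -/
def AvoidsPowPlus (a : ℚ) (w : List Bool) : Prop :=
  ∀ u : List Bool, u ≠ [] → u <:+: w → exponent u ≤ a

/-- An infinite word avoids α-powers. -/
def AvoidsPowSeq (a : ℚ) (w : ℕ → Bool) : Prop :=
  ∀ u : List Bool, u ≠ [] → IsFactorSeq u w → exponent u < a

/-- An infinite word avoids α⁺-powers. -/
def AvoidsPowPlusSeq (a : ℚ) (w : ℕ → Bool) : Prop :=
  ∀ u : List Bool, u ≠ [] → IsFactorSeq u w → exponent u ≤ a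

/-- An overlap is a word of the form a x a x a, with a a single letter. -/
def IsOverlap (u : List Bool) : Prop :=
  ∃ (a : Bool) (x : List Bool), u = [a] ++ x ++ [a] ++ x ++ [a]

/-- Overlap-freeness for finite words. -/
def OverlapFree (w : List Bool) : Prop := ∀ u : List Bool, u <:+: w → ¬ IsOverlap u

/-- Overlap-freeness for infinite words. -/
def OverlapFreeSeq (w : ℕ → Bool) : Prop := ∀ u : List Bool, IsFactorSeq u w → ¬ IsOverlap u

/-- The Thue–Morse word t = 0110100110010110⋯ : t[n] = 1 iff the number of
ones in the binary expansion of n is odd. -/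
def thueMorse : ℕ → Bool := fun n => (Nat.digits 2 n).count 1 % 2 == 1

/-- The complement t̄ of the Thue–Morse word. -/
def tmbar : ℕ → Bool := fun n => ! thueMorse n

/-- The infinite word obtained by prepending the finite word `u` to `w`. -/
def appendSeq (u : List Bool) (w : ℕ → Bool) : ℕ → Bool :=
  fun n => if h : n < u.length then u.get ⟨n, h⟩ else w (n - u.length)

/-- Lexicographic order on infinite binary words (with 0 < 1). -/
def seqLE (v w : ℕ → Bool) : Prop :=
  v = w ∨ ∃ n : ℕ, (∀ i < n, v i = w i) ∧ v n = false ∧ w n = true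

/-- The word x₀ μ(x₁) μ²(x₂) ⋯ μ^{n-1}(x_{n-1}). -/
def restivoJoin (x : ℕ → List Bool) (n : ℕ) : List Bool :=
  ((List.range n).map (fun i => mu^[i] (x i))).flatten

/-- Finite Restivo words: x₀ μ(x₁) ⋯ μ^t(x_t) with all xᵢ ∈ S. -/
def IsRestivo (w : List Bool) : Prop :=
  ∃ (t : ℕ) (x : ℕ → List Bool), (∀ i ≤ t, x i ∈ S) ∧ w = restivoJoin x (t + 1)

/-- Infinite Restivo words: x₀ μ(x₁) μ²(x₂) ⋯ with all xᵢ ∈ S and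
infinitely many xᵢ nonempty. -/
def IsRestivoSeq (w : ℕ → Bool) : Prop :=
  ∃ x : ℕ → List Bool, (∀ i, x i ∈ S) ∧ (∀ N : ℕ, ∃ i ≥ N, x i ≠ []) ∧
    ∀ n : ℕ, PrefixSeq (restivoJoin x n) w

theorem mu_append (a b : List Bool) : mu (a ++ b) = mu a ++ mu b := by
  simp [mu]

theorem length_mu (a : List Bool) : (mu a).length = 2 * a.length := by
  induction a with
  | nil => rfl
  | cons b l ih =>
    have h : mu (b :: l) = [b, !b] ++ mu l := by simp [mu]
    rw [h, List.length_append, ih]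
    simp
    omega

theorem iterate_mu_append (n : ℕ) (a b : List Bool) :
    mu^[n] (a ++ b) = mu^[n] a ++ mu^[n] b := by
  induction n generalizing a b with
  | zero => rfl
  | succ n ih => simp only [Function.iterate_succ_apply, mu_append, ih]

theorem length_iterate_mu (n : ℕ) (a : List Bool) :
    (mu^[n] a).length = 2 ^ n * a.length := by
  induction n with
  | zero => simp
  | succ n ih => rw [Function.iterate_succ_apply', length_mu, ih]; ring

theorem restivoJoin_succ (x : ℕ → List Bool) (n : ℕ) :
    restivoJoin x (n + 1) = restivoJoin x n ++ mu^[n] (x n) := by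
  simp [restivoJoin, List.range_succ]

theorem restivoJoin_prefix_of_le (x : ℕ → List Bool) {m n : ℕ} (h : m ≤ n) :
    restivoJoin x m <+: restivoJoin x n := by
  induction n, h using Nat.le_induction with
  | base => exact List.prefix_rfl
  | succ n _ ih => exact ih.trans (restivoJoin_succ x n ▸ List.prefix_append _ _)

theorem le_length_restivoJoin {x : ℕ → List Bool} (hx : ∀ i, x i ≠ []) (n : ℕ) :
    n ≤ (restivoJoin x n).length := by
  induction n with
  | zero => simp
  | succ n ih =>
    rw [restivoJoin_succ, List.length_append, length_iterate_mu]
    have := Nat.mul_pos (Nat.two_pow_pos n) (List.length_pos_of_ne_nil (hx n))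
    omega

/-- When every `x i` is nonempty, the words `restivoJoin x n` converge to an infinite word. -/
theorem exists_prefixSeq_restivoJoin {x : ℕ → List Bool} (hx : ∀ i, x i ≠ []) :
    ∃ w : ℕ → Bool, ∀ n, PrefixSeq (restivoJoin x n) w := by
  refine ⟨fun n => (restivoJoin x (n + 1)).getD n false, fun n j hj => ?_⟩
  have hj' : j < (restivoJoin x (j + 1)).length := le_length_restivoJoin hx (j + 1)
  simp only [List.getD_eq_getElem _ _ hj', List.get_eq_getElem]
  rcases le_total n (j + 1) with h | h
  · exact (restivoJoin_prefix_of_le x h).getElem hj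
  · exact ((restivoJoin_prefix_of_le x h).getElem hj').symm

theorem IsFactorSeq.of_infix {u v : List Bool} {w : ℕ → Bool} (huv : u <:+: v)
    (hv : PrefixSeq v w) : IsFactorSeq u w := by
  obtain ⟨a, b, rfl⟩ := huv
  refine ⟨a.length, fun j hj => ?_⟩
  rw [← hv (a.length + j) (by simp; omega)]
  simp [hj]

/-- Deleting the first letter of a word `P ++ A = A ++ P` leaves a word of period `P.length`. -/
theorem hasPeriod_of_cons_eq {P A u : List Bool} {c : Bool} (hP : P ≠ [])
    (hle : P.length ≤ u.length) (h : c :: u = P ++ A) (hcomm : P ++ A = A ++ P) :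
    HasPeriod u P.length := by
  refine ⟨List.length_pos_of_ne_nil hP, hle, fun i hi => ?_⟩
  have hlen : u.length + 1 = P.length + A.length := by simpa using congrArg List.length h
  have hL : u.getD i false = A.getD (i + 1) false := by
    rw [← List.getD_cons_succ (x := c), h, hcomm, List.getD_append _ _ _ _ (by omega)]
  have hR : u.getD (i + P.length) false = A.getD (i + 1) false := by
    rw [← List.getD_cons_succ (x := c), h, List.getD_append_right _ _ _ _ (by omega)]
    congr 1
    omega
  rw [hL, hR]

theorem HasPeriod.div_le_exponent {u : List Bool} {p : ℕ} (h : HasPeriod u p) :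
    (u.length : ℚ) / p ≤ exponent u := by
  have hle : leastPeriod u ≤ p := Nat.sInf_le h
  have hpos : 1 ≤ leastPeriod u := (Nat.sInf_mem (s := {p | HasPeriod u p}) ⟨p, h⟩).1
  unfold exponent
  have : (0 : ℚ) < leastPeriod u := by exact_mod_cast hpos
  gcongr

/-- The word `1 μ(1) ⋯ μ^{k-1}(1) μ^k(00) μ^{k+1}(0) μ^{k+2}(0) ⋯` is given by this sequence. -/
def nearFourthPowerSeq (k i : ℕ) : List Bool :=
  if i < k then [true] else if i = k then [false, false] else [false]

theorem nearFourthPowerSeq_mem_S (k i : ℕ) : nearFourthPowerSeq k i ∈ S := by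
  unfold nearFourthPowerSeq S
  split_ifs <;> simp

theorem nearFourthPowerSeq_ne_nil (k i : ℕ) : nearFourthPowerSeq k i ≠ [] := by
  unfold nearFourthPowerSeq
  split_ifs <;> simp

theorem iterate_mu_succ_false (n : ℕ) :
    mu^[n + 1] [false] = mu^[n] [false] ++ mu^[n] [true] := by
  rw [Function.iterate_succ_apply, ← iterate_mu_append]
  rfl

theorem false_cons_restivoJoin {x : ℕ → List Bool} {n : ℕ} (hx : ∀ i < n, x i = [true]) :
    false :: restivoJoin x n = mu^[n] [false] := by
  induction n with
  | zero => rfl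
  | succ n ih =>
    rw [restivoJoin_succ, ← List.cons_append, ih fun i hi => hx i (by omega),
      hx n (by omega), iterate_mu_succ_false]

theorem exists_infix_nearFourthPower (k : ℕ) :
    ∃ u : List Bool, u <:+: restivoJoin (nearFourthPowerSeq k) (k + 2) ∧
      u.length = 2 ^ (k + 2) - 1 ∧ HasPeriod u (2 ^ k) := by
  set x := nearFourthPowerSeq k with hx
  set P := mu^[k] [false] with hP
  have hPlen : P.length = 2 ^ k := by simp [hP, length_iterate_mu]
  have hPne : P ≠ [] := by
    rw [← List.length_pos_iff, hPlen]
    positivity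
  have hJ : false :: restivoJoin x k = P :=
    false_cons_restivoJoin fun i hi => by simp [hx, nearFourthPowerSeq, hi]
  have hxk : mu^[k] (x k) = P ++ P := by
    rw [hP, ← iterate_mu_append]
    simp [hx, nearFourthPowerSeq]
  have hxk1 : mu^[k + 1] (x (k + 1)) = P ++ mu^[k] [true] := by
    rw [hP, ← iterate_mu_succ_false]
    simp [hx, nearFourthPowerSeq]
  have hcons : false :: (restivoJoin x k ++ (P ++ P ++ P)) = P ++ (P ++ P ++ P) := by
    rw [← List.cons_append, hJ]
  have hlen : (restivoJoin x k ++ (P ++ P ++ P)).length = 2 ^ (k + 2) - 1 := by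
    have := congrArg List.length hcons
    simp only [List.length_cons, List.length_append, hPlen] at this ⊢
    rw [pow_add]
    omega
  refine ⟨restivoJoin x k ++ (P ++ P ++ P), ?_, hlen, ?_⟩
  · rw [restivoJoin_succ, restivoJoin_succ, hxk, hxk1]
    refine ⟨[], mu^[k] [true], by simp⟩
  · rw [← hPlen]
    refine hasPeriod_of_cons_eq hPne ?_ hcons (by simp)
    simp only [List.length_append]
    omega

theorem exists_nearFourthPower (t : ℕ) (ht : 2 ≤ t) :
    ∃ u : List Bool, u <:+: restivoJoin (nearFourthPowerSeq (t - 2)) t ∧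
      u.length = 2 ^ t - 1 ∧ HasPeriod u (2 ^ (t - 2)) ∧ exponent u ≥ 4 - 4 / 2 ^ t := by
  obtain ⟨k, rfl⟩ : ∃ k, t = k + 2 := ⟨t - 2, by omega⟩
  rw [Nat.add_sub_cancel]
  obtain ⟨u, hu, hlen, hper⟩ := exists_infix_nearFourthPower k
  refine ⟨u, hu, hlen, hper, le_trans (le_of_eq ?_) hper.div_le_exponent⟩
  rw [hlen, Nat.cast_sub Nat.one_le_two_pow]
  push_cast
  field_simp
  ring

/-- For every t ≥ 3 there is a finite Restivo word x₀ μ(x₁) ⋯ μ^{t-1}(x_{t-1})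
containing a factor of length 2^t − 1 with period 2^{t-2}, hence a factor of
exponent ≥ 4(1 − 2^{-t}); consequently for each real e < 4 some infinite
Restivo word has a nonempty factor of exponent > e, so the bound 4 is best
possible. -/
theorem restivo_fourthPower_bound_sharp :
    (∀ t : ℕ, 3 ≤ t → ∃ x : ℕ → List Bool, (∀ i < t, x i ∈ S) ∧
      ∃ u : List Bool, u <:+: restivoJoin x t ∧ u.length = 2 ^ t - 1 ∧
        HasPeriod u (2 ^ (t - 2)) ∧ exponent u ≥ 4 - 4 / 2 ^ t) ∧
    ∀ e : ℝ, e < 4 → ∃ w : ℕ → Bool, IsRestivoSeq w ∧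
      ∃ u : List Bool, u ≠ [] ∧ IsFactorSeq u w ∧ ((exponent u : ℚ) : ℝ) > e := by
  refine ⟨fun t ht => ⟨nearFourthPowerSeq (t - 2), fun i _ => nearFourthPowerSeq_mem_S _ i,
    exists_nearFourthPower t (by omega)⟩, fun e he => ?_⟩
  obtain ⟨n, hn⟩ := exists_pow_lt_of_lt_one (show 0 < (4 - e) / 4 by linarith)
    (show (1 / 2 : ℝ) < 1 by norm_num)
  obtain ⟨u, hu, hlen, -, hexp⟩ := exists_nearFourthPower (n + 3) (by omega)
  obtain ⟨w, hw⟩ := exists_prefixSeq_restivoJoin (nearFourthPowerSeq_ne_nil (n + 3 - 2))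
  refine ⟨w, ⟨_, nearFourthPowerSeq_mem_S _,
    fun N => ⟨N, le_rfl, nearFourthPowerSeq_ne_nil _ N⟩, hw⟩, u, ?_, .of_infix hu (hw _), ?_⟩
  · rintro rfl
    have := Nat.one_lt_two_pow (n := n + 3) (by omega)
    simp at hlen
    omega
  · have hexp' : (4 - 4 / 2 ^ (n + 3) : ℝ) ≤ (exponent u : ℚ) := by
      simpa using (Rat.cast_le (K := ℝ)).mpr hexp
    have hpow : (4 / 2 ^ (n + 3) : ℝ) ≤ 4 * (1 / 2) ^ n := by
      rw [one_div, inv_pow, ← div_eq_mul_inv]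
      gcongr <;> norm_num
    linarith
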